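/- arXiv:math/0209258 — 12 statements merged into one kernel-verified Lean document; each statement's English description precedes it below -/
import Mathlib

section
/- Let U ⊆ ℂ be a nonempty open connected set, let G, g, a be holomorphic functions on U such that G' is nowhere zero on U, a²·g' = G' on U, and set b := −g·a. Define C := a'/G', D := b'/G', A := G·C − a, B := G·D − b. Then A·D − B·C = 1 at every point of U (the determinant identity in Small's formula). -/
open Complex

/-- Small's formula: the determinant identity `A·D − B·C = 1`. -/
theorem stmt_0 (U : Set ℂ) (hUo : IsOpen U) (hUc : IsConnected U)
    (G g a b C D A B : ℂ → ℂ)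
    (hG : DifferentiableOn ℂ G U) (hg : DifferentiableOn ℂ g U)
    (ha : DifferentiableOn ℂ a U)
    (hG' : ∀ z ∈ U, deriv G z ≠ 0)
    (hag : ∀ z ∈ U, (a z) ^ 2 * deriv g z = deriv G z)
    (hb : ∀ z, b z = -(g z * a z))
    (hC : ∀ z, C z = deriv a z / deriv G z)
    (hD : ∀ z, D z = deriv b z / deriv G z)
    (hA : ∀ z, A z = G z * C z - a z)
    (hB : ∀ z, B z = G z * D z - b z) :
    ∀ z ∈ U, A z * D z - B z * C z = 1 := by
  intro z hz
  have hgz : DifferentiableAt ℂ g z := hg.differentiableAt (hUo.mem_nhds hz)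
  have haz : DifferentiableAt ℂ a z := ha.differentiableAt (hUo.mem_nhds hz)
  have hbz : deriv b z = -(deriv g z * a z + g z * deriv a z) := by
    rw [funext hb]
    exact (hgz.hasDerivAt.mul haz.hasDerivAt).neg.deriv
  have hne := hG' z hz
  rw [hA, hB, hC, hD, hb, hbz]
  field_simp
  linear_combination deriv G z * hag z hz
end

section
/- Let U ⊆ ℂ be a nonempty open connected set, let G, g, a be holomorphic functions on U such that G' is nowhere zero on U, a²·g' = G' on U, and set b := −g·a, C := a'/G', D := b'/G', A := G·C − a, B := G·D − b. Then A' = G·C' and B' = G·D' at every point of U; in particular A'·D' − B'·C' = 0 on U (the curve is null) and G is its hyperbolic Gauss map. -/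
open Complex

/-- If `F = f' / G'` on the whole plane, then `G * F - f` has derivative `G * F'` wherever
`f` and `G` are holomorphic and `G'` does not vanish. -/
theorem deriv_mul_quotient_sub {U : Set ℂ} (hU : IsOpen U) {G f F H : ℂ → ℂ}
    (hG : DifferentiableOn ℂ G U) (hf : DifferentiableOn ℂ f U)
    (hG' : ∀ z ∈ U, deriv G z ≠ 0) (hF : ∀ z, F z = deriv f z / deriv G z)
    (hH : ∀ z, H z = G z * F z - f z) {z : ℂ} (hz : z ∈ U) :
    deriv H z = G z * deriv F z := by
  have hUz : U ∈ nhds z := hU.mem_nhds hz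
  have hGz := hG.differentiableAt hUz
  have hfz := hf.differentiableAt hUz
  have hFz : DifferentiableAt ℂ F z := by
    rw [funext hF]
    exact ((hf.deriv hU).differentiableAt hUz).fun_div
      ((hG.deriv hU).differentiableAt hUz) (hG' z hz)
  have hHz := (hGz.hasDerivAt.fun_mul hFz.hasDerivAt).fun_sub hfz.hasDerivAt
  rw [funext hH, hHz.deriv, hF z, mul_div_cancel₀ _ (hG' z hz)]
  ring

/-- Small's formula produces a null curve with hyperbolic Gauss map `G`. -/
theorem stmt_1 (U : Set ℂ) (hUo : IsOpen U) (hUc : IsConnected U)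
    (G g a b C D A B : ℂ → ℂ)
    (hG : DifferentiableOn ℂ G U) (hg : DifferentiableOn ℂ g U)
    (ha : DifferentiableOn ℂ a U)
    (hG' : ∀ z ∈ U, deriv G z ≠ 0)
    (hag : ∀ z ∈ U, (a z) ^ 2 * deriv g z = deriv G z)
    (hb : ∀ z, b z = -(g z * a z))
    (hC : ∀ z, C z = deriv a z / deriv G z)
    (hD : ∀ z, D z = deriv b z / deriv G z)
    (hA : ∀ z, A z = G z * C z - a z)
    (hB : ∀ z, B z = G z * D z - b z) :
    ∀ z ∈ U, deriv A z = G z * deriv C z ∧ deriv B z = G z * deriv D z ∧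
      deriv A z * deriv D z - deriv B z * deriv C z = 0 := by
  intro z hz
  have hbU : DifferentiableOn ℂ b U := by
    rw [funext hb]
    exact (hg.fun_mul ha).fun_neg
  have hA' := deriv_mul_quotient_sub hUo hG ha hG' hC hA hz
  have hB' := deriv_mul_quotient_sub hUo hG hbU hG' hD hB hz
  refine ⟨hA', hB', ?_⟩
  rw [hA', hB']
  ring
end

section
/- Let U ⊆ ℂ be a nonempty open connected set, let G, g, a be holomorphic functions on U such that G' and a are nowhere zero on U, a²·g' = G' on U, and set b := −g·a, C := a'/G', D := b'/G', A := G·C − a, B := G·D − b. Then B' = −g·A' and D' = −g·C' at every point of U; that is, g is the secondary Gauss map of the null curve produced by Small's formula. -/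
open Complex

/-- `g` is the secondary Gauss map of the null curve produced by Small's formula. -/
theorem stmt_2 (U : Set ℂ) (hUo : IsOpen U) (hUc : IsConnected U)
    (G g a b C D A B : ℂ → ℂ)
    (hG : DifferentiableOn ℂ G U) (hg : DifferentiableOn ℂ g U)
    (ha : DifferentiableOn ℂ a U)
    (hG' : ∀ z ∈ U, deriv G z ≠ 0)
    (ha0 : ∀ z ∈ U, a z ≠ 0)
    (hag : ∀ z ∈ U, (a z) ^ 2 * deriv g z = deriv G z)
    (hb : ∀ z, b z = -(g z * a z))
    (hC : ∀ z, C z = deriv a z / deriv G z)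
    (hD : ∀ z, D z = deriv b z / deriv G z)
    (hA : ∀ z, A z = G z * C z - a z)
    (hB : ∀ z, B z = G z * D z - b z) :
    ∀ z ∈ U, deriv B z = -(g z * deriv A z) ∧ deriv D z = -(g z * deriv C z) := by
  intro z hz
  have hasDeriv {f : ℂ → ℂ} (hf : DifferentiableOn ℂ f U) {w : ℂ} (hw : w ∈ U) :
      HasDerivAt f (deriv f w) w :=
    (hf.differentiableAt (hUo.mem_nhds hw)).hasDerivAt
  have b_deriv (w : ℂ) (hw : w ∈ U) :
      HasDerivAt b (-(deriv g w * a w + g w * deriv a w)) w := by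
    rw [funext hb]
    exact ((hasDeriv hg hw).mul (hasDeriv ha hw)).neg
  have D_eq (w : ℂ) (hw : w ∈ U) : D w = -(a w)⁻¹ - g w * C w := by
    have h1 := hG' w hw
    have h2 := ha0 w hw
    rw [hD, hC, (b_deriv w hw).deriv]
    field_simp
    linear_combination -hag w hw
  have hC_deriv : HasDerivAt C (deriv C z) z := by
    refine DifferentiableAt.hasDerivAt ?_
    rw [funext hC]
    exact (hasDeriv (ha.deriv hUo) hz).differentiableAt.fun_div
      (hasDeriv (hG.deriv hUo) hz).differentiableAt (hG' z hz)
  have hD_deriv : HasDerivAt D (-(g z * deriv C z)) z := by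
    have h := ((hasDeriv ha hz).inv (ha0 z hz)).neg.sub ((hasDeriv hg hz).mul hC_deriv)
    have hev : D =ᶠ[nhds z] (-a⁻¹ - g * C) :=
      Filter.eventuallyEq_of_mem (hUo.mem_nhds hz) D_eq
    refine (h.congr_of_eventuallyEq hev).congr_deriv ?_
    have h1 := hG' z hz
    have h2 := ha0 z hz
    rw [hC z]
    field_simp
    linear_combination -deriv a z * hag z hz
  have hA_deriv : deriv A z = G z * deriv C z := by
    rw [funext hA, (((hasDeriv hG hz).fun_mul hC_deriv).fun_sub (hasDeriv ha hz)).deriv, hC z,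
      mul_div_cancel₀ _ (hG' z hz)]
    ring
  have hB_deriv : deriv B z = G z * -(g z * deriv C z) := by
    rw [funext hB, (((hasDeriv hG hz).fun_mul hD_deriv).fun_sub (b_deriv z hz)).deriv, hD z,
      (b_deriv z hz).deriv, mul_div_cancel₀ _ (hG' z hz)]
    ring
  refine ⟨?_, hD_deriv.deriv⟩
  rw [hB_deriv, hA_deriv]
  ring
end

section
/- Let U ⊆ ℂ be a nonempty open connected set and let A, B, C, D, G, g be holomorphic functions on U with A·D − B·C = 1, A' = G·C', B' = G·D', B' = −g·A' and D' = −g·C' on U, and suppose C' is nowhere zero on U. Define a := G·C − A and b := G·D − B. Then b = −g·a and G' = a²·g' at every point of U. Consequently the curve is recovered from (G,g) by Small's formula. -/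
open Complex

/-- Converse of Small's formula: `b = −g·a` and `G' = a²·g'`. -/
theorem stmt_4 (U : Set ℂ) (hUo : IsOpen U) (hUc : IsConnected U)
    (A B C D G g a b : ℂ → ℂ)
    (hA : DifferentiableOn ℂ A U) (hB : DifferentiableOn ℂ B U)
    (hC : DifferentiableOn ℂ C U) (hD : DifferentiableOn ℂ D U)
    (hG : DifferentiableOn ℂ G U) (hg : DifferentiableOn ℂ g U)
    (hdet : ∀ z ∈ U, A z * D z - B z * C z = 1)
    (hGA : ∀ z ∈ U, deriv A z = G z * deriv C z)
    (hGB : ∀ z ∈ U, deriv B z = G z * deriv D z)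
    (hgB : ∀ z ∈ U, deriv B z = -(g z * deriv A z))
    (hgD : ∀ z ∈ U, deriv D z = -(g z * deriv C z))
    (hC' : ∀ z ∈ U, deriv C z ≠ 0)
    (hadef : ∀ z, a z = G z * C z - A z)
    (hbdef : ∀ z, b z = G z * D z - B z) :
    ∀ z ∈ U, b z = -(g z * a z) ∧ deriv G z = (a z) ^ 2 * deriv g z := by
  have hb : ∀ z ∈ U, b z = -(g z * a z) := by
    intro z hz
    have hU := hUo.mem_nhds hz
    have hdet' := (((hA.differentiableAt hU).hasDerivAt.mul (hD.differentiableAt hU).hasDerivAt).sub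
      ((hB.differentiableAt hU).hasDerivAt.mul (hC.differentiableAt hU).hasDerivAt)).unique
      ((hasDerivAt_const z (1 : ℂ)).congr_of_eventuallyEq
        (Filter.eventuallyEq_of_mem hU hdet))
    rw [hGB z hz, hGA z hz, hgD z hz] at hdet'
    apply mul_right_cancel₀ (hC' z hz)
    rw [hadef, hbdef]
    linear_combination hdet'
  intro z hz
  refine ⟨hb z hz, ?_⟩
  have hU := hUo.mem_nhds hz
  have dG := (hG.differentiableAt hU).hasDerivAt
  have da : HasDerivAt a (deriv G z * C z) z := by
    rw [funext hadef]
    refine ((dG.mul (hC.differentiableAt hU).hasDerivAt).sub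
      (hA.differentiableAt hU).hasDerivAt).congr_deriv ?_
    rw [hGA z hz]
    ring
  have db : HasDerivAt b (deriv G z * D z) z := by
    rw [funext hbdef]
    refine ((dG.mul (hD.differentiableAt hU).hasDerivAt).sub
      (hB.differentiableAt hU).hasDerivAt).congr_deriv ?_
    rw [hGB z hz]
    ring
  have hb' := db.unique
    (((hg.differentiableAt hU).hasDerivAt.mul da).neg.congr_of_eventuallyEq
      (Filter.eventuallyEq_of_mem hU hb))
  have haDbC : a z * D z - b z * C z = -1 := by
    rw [hadef, hbdef]
    linear_combination -hdet z hz
  linear_combination (-a z) * hb' + deriv G z * haDbC + deriv G z * C z * hb z hz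
end

section
/- Let U ⊆ ℂ be a nonempty open connected set, let G and G* be holomorphic functions on U with G − G* nowhere zero on U, and let ξ be a nowhere-zero holomorphic function on U satisfying ξ' = ξ·G'/(G − G*). Define A := G/ξ, B := ξ·G*/(G − G*), C := 1/ξ, D := ξ/(G − G*). Then at every point of U: A·D − B·C = 1, D·A' − B·C' = 0 (so (A,B,C,D) is a Legendrian curve), A/C = G, B/D = G*, and A·C' − C·A' = −G'/ξ². -/
open Complex

/-- The representation formula for Legendrian curves in terms of the two
hyperbolic Gauss maps `G`, `G*`. -/
theorem stmt_8 (U : Set ℂ) (hUo : IsOpen U) (hUc : IsConnected U)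
    (G Gs ξ A B C D : ℂ → ℂ)
    (hG : DifferentiableOn ℂ G U) (hGs : DifferentiableOn ℂ Gs U)
    (hξ : DifferentiableOn ℂ ξ U)
    (hGGs : ∀ z ∈ U, G z - Gs z ≠ 0)
    (hξ0 : ∀ z ∈ U, ξ z ≠ 0)
    (hξ' : ∀ z ∈ U, deriv ξ z = ξ z * deriv G z / (G z - Gs z))
    (hAdef : ∀ z, A z = G z / ξ z)
    (hBdef : ∀ z, B z = ξ z * Gs z / (G z - Gs z))
    (hCdef : ∀ z, C z = 1 / ξ z)
    (hDdef : ∀ z, D z = ξ z / (G z - Gs z)) :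
    ∀ z ∈ U, A z * D z - B z * C z = 1 ∧
      D z * deriv A z - B z * deriv C z = 0 ∧
      A z / C z = G z ∧ B z / D z = Gs z ∧
      A z * deriv C z - C z * deriv A z = -deriv G z / (ξ z) ^ 2 := by
  intro z hz
  have hUz : U ∈ nhds z := hUo.mem_nhds hz
  have hGd : HasDerivAt G (deriv G z) z := (hG.differentiableAt hUz).hasDerivAt
  have hξd : HasDerivAt ξ (deriv ξ z) z := (hξ.differentiableAt hUz).hasDerivAt
  have hx : ξ z ≠ 0 := hξ0 z hz
  have hg : G z - Gs z ≠ 0 := hGGs z hz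
  have hA' : deriv A z = (deriv G z * ξ z - G z * deriv ξ z) / ξ z ^ 2 := by
    rw [funext hAdef]
    exact (hGd.div hξd hx).deriv
  have hC' : deriv C z = -deriv ξ z / ξ z ^ 2 := by
    have hC : C = fun w => (ξ w)⁻¹ := funext fun w => by rw [hCdef, one_div]
    rw [hC]
    exact (hξd.inv hx).deriv
  rw [hA', hC', hξ' z hz, hAdef, hBdef, hCdef, hDdef]
  refine ⟨?_, ?_, ?_, ?_, ?_⟩
  · field_simp
  · field_simp
    ring
  · field_simp
  · field_simp
  · field_simp
    ring
end

section
/- Let U ⊆ ℂ be a nonempty open connected set, let G be a holomorphic function on U with G' nowhere zero, let w be a nowhere-zero holomorphic function on U, and let c be a holomorphic function on U with c²·G' = −w (encoding c = i√(w/G')). Define C := c, A := G·c, B := A'/w, D := C'/w. Then at every point of U: A·D − B·C = 1 and D·A' − B·C' = 0 (so (A,B,C,D) is a Legendrian curve), the hyperbolic Gauss map A/C equals G, and the canonical form A·C' − C·A' equals w. -/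
open Complex

/-- Small-type formula for Legendrian curves: from the pair `(G, ω)` one
builds a Legendrian curve with hyperbolic Gauss map `G` and canonical
form `ω`. -/
theorem stmt_10 (U : Set ℂ) (hUo : IsOpen U) (hUc : IsConnected U)
    (G w c A B C D : ℂ → ℂ)
    (hG : DifferentiableOn ℂ G U) (hw : DifferentiableOn ℂ w U)
    (hc : DifferentiableOn ℂ c U)
    (hG' : ∀ z ∈ U, deriv G z ≠ 0)
    (hw0 : ∀ z ∈ U, w z ≠ 0)
    (hcsq : ∀ z ∈ U, (c z) ^ 2 * deriv G z = -w z)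
    (hCdef : ∀ z, C z = c z)
    (hAdef : ∀ z, A z = G z * c z)
    (hBdef : ∀ z, B z = deriv A z / w z)
    (hDdef : ∀ z, D z = deriv C z / w z) :
    ∀ z ∈ U, A z * D z - B z * C z = 1 ∧
      D z * deriv A z - B z * deriv C z = 0 ∧
      A z / C z = G z ∧
      A z * deriv C z - C z * deriv A z = w z := by
  intro z hz
  have hwz := hw0 z hz
  have hcz : c z ≠ 0 := by
    intro h
    have hsq := hcsq z hz
    rw [h] at hsq
    exact hwz (by linear_combination hsq)
  have hC : C = c := funext hCdef
  have hA : A = fun z => G z * c z := funext hAdef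
  have hA' : deriv A z = deriv G z * c z + G z * deriv c z := by
    rw [hA]
    exact ((hG.differentiableAt (hUo.mem_nhds hz)).hasDerivAt.mul
      (hc.differentiableAt (hUo.mem_nhds hz)).hasDerivAt).deriv
  have hcanon : A z * deriv C z - C z * deriv A z = w z := by
    rw [hA', hAdef, hC]
    linear_combination -(hcsq z hz)
  refine ⟨?_, ?_, ?_, hcanon⟩
  · rw [hBdef, hDdef]
    field_simp
    linear_combination hcanon
  · rw [hBdef, hDdef]
    ring
  · rw [hAdef, hCdef, mul_div_cancel_right₀ _ hcz]
end

section
/- Let U ⊆ ℂ be a nonempty open connected set and let A, B, C, D be holomorphic functions on U with A·D − B·C = 1 and D·A' − B·C' = 0 on U, and suppose C and D are nowhere zero on U. Set G := A/C and G* := B/D. Then the Hopf differential coefficient satisfies (A·C' − C·A')·(D·B' − B·D') = −G'·(G*)'/(G − G*)² at every point of U. -/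
open Complex

/-- The Hopf differential of a Legendrian curve:
`ω·θ = −G'·(G*)'/(G − G*)²`. -/
theorem stmt_11 (U : Set ℂ) (hUo : IsOpen U) (hUc : IsConnected U)
    (A B C D G Gs : ℂ → ℂ)
    (hA : DifferentiableOn ℂ A U) (hB : DifferentiableOn ℂ B U)
    (hC : DifferentiableOn ℂ C U) (hD : DifferentiableOn ℂ D U)
    (hdet : ∀ z ∈ U, A z * D z - B z * C z = 1)
    (hLeg : ∀ z ∈ U, D z * deriv A z - B z * deriv C z = 0)
    (hC0 : ∀ z ∈ U, C z ≠ 0) (hD0 : ∀ z ∈ U, D z ≠ 0)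
    (hGdef : ∀ z, G z = A z / C z)
    (hGsdef : ∀ z, Gs z = B z / D z) :
    ∀ z ∈ U, (A z * deriv C z - C z * deriv A z)
        * (D z * deriv B z - B z * deriv D z)
      = -(deriv G z * deriv Gs z) / (G z - Gs z) ^ 2 := by
  intro z hz
  have hU := hUo.mem_nhds hz
  have hC0z := hC0 z hz
  have hD0z := hD0 z hz
  have hG : deriv G z = (deriv A z * C z - A z * deriv C z) / C z ^ 2 := by
    rw [funext hGdef]
    exact deriv_fun_div (hA.differentiableAt hU) (hC.differentiableAt hU) hC0z
  have hGs : deriv Gs z = (deriv B z * D z - B z * deriv D z) / D z ^ 2 := by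
    rw [funext hGsdef]
    exact deriv_fun_div (hB.differentiableAt hU) (hD.differentiableAt hU) hD0z
  have hdiff : G z - Gs z = 1 / (C z * D z) := by
    rw [hGdef, hGsdef, div_sub_div _ _ hC0z hD0z, mul_comm (C z) (B z), hdet z hz]
  rw [hG, hGs, hdiff]
  field_simp
  ring
end

section
/- Let U ⊆ ℂ be a nonempty open connected set, let G, g be holomorphic on U with G' and g' nowhere zero on U, and let (A,B,C,D) and (Ã,B̃,C̃,D̃) be two quadruples of holomorphic functions on U, each satisfying: the determinant condition (A·D − B·C = 1), A' = G·C', B' = G·D', B' = −g·A', D' = −g·C' (and the same with tildes), with C' and C̃' nowhere zero on U. Then there exists ε ∈ {1, −1} such that Ã = ε·A, B̃ = ε·B, C̃ = ε·C, D̃ = ε·D on U. That is, a null curve in PSL(2,ℂ) is uniquely determined by the pair (G,g) of its hyperbolic and secondary Gauss maps. -/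
open Complex

theorem hasDerivAt_deriv_of_isOpen {U : Set ℂ} {f : ℂ → ℂ}
    (hf : DifferentiableOn ℂ f U) (hU : IsOpen U) {z : ℂ} (hz : z ∈ U) :
    HasDerivAt f (deriv f z) z :=
  (hf.differentiableAt (hU.mem_nhds hz)).hasDerivAt

/-- Holomorphic functions that agree on an open set have the same derivative there. -/
theorem HasDerivAt.unique_of_eqOn {U : Set ℂ} (hU : IsOpen U) {f h : ℂ → ℂ} {f' h' z : ℂ}
    (hz : z ∈ U) (hfh : Set.EqOn f h U) (hf : HasDerivAt f f' z) (hh : HasDerivAt h h' z) :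
    f' = h' :=
  (hf.congr_of_eventuallyEq (hfh.symm.eventuallyEq_of_mem (hU.mem_nhds hz))).unique hh

section NullCurve

variable {U : Set ℂ} {G g A B C D : ℂ → ℂ}

/-- The Gauss maps of a null curve are related by the Möbius action of the curve:
`G (D + g C) = B + g A`. -/
theorem gauss_map_relation (hU : IsOpen U)
    (hA : DifferentiableOn ℂ A U) (hB : DifferentiableOn ℂ B U)
    (hC : DifferentiableOn ℂ C U) (hD : DifferentiableOn ℂ D U)
    (hdet : ∀ z ∈ U, A z * D z - B z * C z = 1)
    (hGA : ∀ z ∈ U, deriv A z = G z * deriv C z)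
    (hgB : ∀ z ∈ U, deriv B z = -(g z * deriv A z))
    (hgD : ∀ z ∈ U, deriv D z = -(g z * deriv C z))
    (hC' : ∀ z ∈ U, deriv C z ≠ 0) {z : ℂ} (hz : z ∈ U) :
    G z * (D z + g z * C z) = B z + g z * A z := by
  have h := HasDerivAt.unique_of_eqOn hU hz hdet
    (((hasDerivAt_deriv_of_isOpen hA hU hz).mul (hasDerivAt_deriv_of_isOpen hD hU hz)).sub
      ((hasDerivAt_deriv_of_isOpen hB hU hz).mul (hasDerivAt_deriv_of_isOpen hC hU hz)))
    (hasDerivAt_const z (1 : ℂ))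
  rw [hgB z hz, hgD z hz, hGA z hz] at h
  apply mul_left_cancel₀ (hC' z hz)
  linear_combination h

/-- The determinant condition in terms of the Gauss maps: `(A - G C) (D + g C) = 1`. -/
theorem sub_mul_add_eq_one
    (hdet : ∀ z ∈ U, A z * D z - B z * C z = 1)
    (hrel : ∀ z ∈ U, G z * (D z + g z * C z) = B z + g z * A z) {z : ℂ} (hz : z ∈ U) :
    (A z - G z * C z) * (D z + g z * C z) = 1 := by
  linear_combination hdet z hz - C z * hrel z hz

/-- The function `A - G C` is a square root of `G' / g'`. -/
theorem deriv_mul_sq_sub_eq_deriv (hU : IsOpen U)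
    (hG : DifferentiableOn ℂ G U) (hg : DifferentiableOn ℂ g U)
    (hA : DifferentiableOn ℂ A U) (hB : DifferentiableOn ℂ B U)
    (hC : DifferentiableOn ℂ C U) (hD : DifferentiableOn ℂ D U)
    (hdet : ∀ z ∈ U, A z * D z - B z * C z = 1)
    (hgB : ∀ z ∈ U, deriv B z = -(g z * deriv A z))
    (hgD : ∀ z ∈ U, deriv D z = -(g z * deriv C z))
    (hrel : ∀ z ∈ U, G z * (D z + g z * C z) = B z + g z * A z) {z : ℂ} (hz : z ∈ U) :
    deriv g z * (A z - G z * C z) ^ 2 = deriv G z := by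
  have dg := hasDerivAt_deriv_of_isOpen hg hU hz
  have h := HasDerivAt.unique_of_eqOn hU hz hrel
    ((hasDerivAt_deriv_of_isOpen hG hU hz).mul ((hasDerivAt_deriv_of_isOpen hD hU hz).add
      (dg.mul (hasDerivAt_deriv_of_isOpen hC hU hz))))
    ((hasDerivAt_deriv_of_isOpen hB hU hz).add (dg.mul (hasDerivAt_deriv_of_isOpen hA hU hz)))
  rw [hgB z hz, hgD z hz] at h
  linear_combination deriv G z * sub_mul_add_eq_one hdet hrel hz - (A z - G z * C z) * h

/-- The derivative of `A - G C` is `-G' C`. -/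
theorem hasDerivAt_sub_mul (hU : IsOpen U) (hG : DifferentiableOn ℂ G U)
    (hA : DifferentiableOn ℂ A U) (hC : DifferentiableOn ℂ C U)
    (hGA : ∀ z ∈ U, deriv A z = G z * deriv C z) {z : ℂ} (hz : z ∈ U) :
    HasDerivAt (fun w => A w - G w * C w) (-(deriv G z * C z)) z := by
  refine ((hasDerivAt_deriv_of_isOpen hA hU hz).sub
    ((hasDerivAt_deriv_of_isOpen hG hU hz).mul
      (hasDerivAt_deriv_of_isOpen hC hU hz))).congr_deriv ?_
  linear_combination hGA z hz

end NullCurve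

/-- A null curve in PSL(2,ℂ) is uniquely determined by the pair `(G, g)` of
its hyperbolic and secondary Gauss maps: two such curves agree up to an
overall sign. -/
theorem stmt_12 (U : Set ℂ) (hUo : IsOpen U) (hUc : IsConnected U)
    (G g A B C D A₂ B₂ C₂ D₂ : ℂ → ℂ)
    (hG : DifferentiableOn ℂ G U) (hg : DifferentiableOn ℂ g U)
    (hA : DifferentiableOn ℂ A U) (hB : DifferentiableOn ℂ B U)
    (hC : DifferentiableOn ℂ C U) (hD : DifferentiableOn ℂ D U)
    (hA₂ : DifferentiableOn ℂ A₂ U) (hB₂ : DifferentiableOn ℂ B₂ U)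
    (hC₂ : DifferentiableOn ℂ C₂ U) (hD₂ : DifferentiableOn ℂ D₂ U)
    (hG' : ∀ z ∈ U, deriv G z ≠ 0) (hg' : ∀ z ∈ U, deriv g z ≠ 0)
    (hdet : ∀ z ∈ U, A z * D z - B z * C z = 1)
    (hGA : ∀ z ∈ U, deriv A z = G z * deriv C z)
    (hGB : ∀ z ∈ U, deriv B z = G z * deriv D z)
    (hgB : ∀ z ∈ U, deriv B z = -(g z * deriv A z))
    (hgD : ∀ z ∈ U, deriv D z = -(g z * deriv C z))
    (hC' : ∀ z ∈ U, deriv C z ≠ 0)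
    (hdet₂ : ∀ z ∈ U, A₂ z * D₂ z - B₂ z * C₂ z = 1)
    (hGA₂ : ∀ z ∈ U, deriv A₂ z = G z * deriv C₂ z)
    (hGB₂ : ∀ z ∈ U, deriv B₂ z = G z * deriv D₂ z)
    (hgB₂ : ∀ z ∈ U, deriv B₂ z = -(g z * deriv A₂ z))
    (hgD₂ : ∀ z ∈ U, deriv D₂ z = -(g z * deriv C₂ z))
    (hC₂' : ∀ z ∈ U, deriv C₂ z ≠ 0) :
    ∃ ε : ℂ, (ε = 1 ∨ ε = -1) ∧
      ∀ z ∈ U, A₂ z = ε * A z ∧ B₂ z = ε * B z ∧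
        C₂ z = ε * C z ∧ D₂ z = ε * D z := by
  have hrel := fun z hz => gauss_map_relation hUo hA hB hC hD hdet hGA hgB hgD hC' (z := z) hz
  have hrel₂ := fun z hz =>
    gauss_map_relation hUo hA₂ hB₂ hC₂ hD₂ hdet₂ hGA₂ hgB₂ hgD₂ hC₂' (z := z) hz
  have hne : ∀ z ∈ U, A z - G z * C z ≠ 0 := fun z hz =>
    left_ne_zero_of_mul_eq_one (sub_mul_add_eq_one hdet hrel hz)
  have hsq : Set.EqOn ((fun z => A₂ z - G z * C₂ z) ^ 2) ((fun z => A z - G z * C z) ^ 2) U :=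
    fun z hz => mul_left_cancel₀ (hg' z hz)
      ((deriv_mul_sq_sub_eq_deriv hUo hG hg hA₂ hB₂ hC₂ hD₂ hdet₂ hgB₂ hgD₂ hrel₂ hz).trans
        (deriv_mul_sq_sub_eq_deriv hUo hG hg hA hB hC hD hdet hgB hgD hrel hz).symm)
  obtain ⟨ε, hε, hP⟩ : ∃ ε : ℂ, (ε = 1 ∨ ε = -1) ∧
      ∀ z ∈ U, A₂ z - G z * C₂ z = ε * (A z - G z * C z) := by
    rcases hUc.isPreconnected.eq_or_eq_neg_of_sq_eq
      (hA₂.sub (hG.mul hC₂)).continuousOn (hA.sub (hG.mul hC)).continuousOn hsq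
      (fun {z} hz => hne z hz) with h | h
    · exact ⟨1, Or.inl rfl, fun z hz => by simpa using h hz⟩
    · exact ⟨-1, Or.inr rfl, fun z hz => by simpa using h hz⟩
  have hε_sq : ε * ε = 1 := by rcases hε with rfl | rfl <;> norm_num
  refine ⟨ε, hε, fun z hz => ?_⟩
  have hCε : C₂ z = ε * C z := by
    have h := HasDerivAt.unique_of_eqOn hUo hz hP (hasDerivAt_sub_mul hUo hG hA₂ hC₂ hGA₂ hz)
      ((hasDerivAt_sub_mul hUo hG hA hC hGA hz).const_mul ε)
    apply mul_left_cancel₀ (hG' z hz)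
    linear_combination -h
  have hAε : A₂ z = ε * A z := by linear_combination hP z hz + G z * hCε
  have hDε : D₂ z = ε * D z := by
    have h₂ := sub_mul_add_eq_one hdet₂ hrel₂ hz
    rw [hP z hz] at h₂
    have h : D₂ z + g z * C₂ z = ε * (D z + g z * C z) := by
      apply mul_left_cancel₀ (hne z hz)
      linear_combination ε * h₂ - ε * sub_mul_add_eq_one hdet hrel hz
        - (A z - G z * C z) * (D₂ z + g z * C₂ z) * hε_sq
    linear_combination h - g z * hCε
  have hBε : B₂ z = ε * B z := by
    linear_combination ε * hrel z hz - hrel₂ z hz + G z * hDε + G z * g z * hCε - g z * hAε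
  exact ⟨hAε, hBε, hCε, hDε⟩
end

section
/- Let U ⊆ ℂ be a nonempty open connected set, let G, G* be holomorphic on U with G − G* nowhere zero, and let (A,B,C,D) and (Ã,B̃,C̃,D̃) be two quadruples of holomorphic functions on U, each satisfying A·D − B·C = 1 and D·A' − B·C' = 0, with C, D, C̃, D̃ nowhere zero on U, and with common hyperbolic Gauss maps: A/C = Ã/C̃ = G and B/D = B̃/D̃ = G*. Then there exists a nonzero constant λ ∈ ℂ such that Ã = λ·A, C̃ = λ·C, B̃ = B/λ, D̃ = D/λ on U. That is, a Legendrian curve with prescribed hyperbolic Gauss maps (G, G*) is unique up to right multiplication by a constant diagonal matrix diag(λ, λ⁻¹). -/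
open Complex

/-- If `A = G * C` and `B = Gs * D` on an open set, the Legendrian condition `D A' - B C' = 0`
becomes the linear equation `G' C + (G - Gs) C' = 0` for `C`. -/
theorem legendrian_linear_ode {U : Set ℂ} (hUo : IsOpen U) {G Gs A B C D : ℂ → ℂ}
    (hG : DifferentiableOn ℂ G U) (hC : DifferentiableOn ℂ C U)
    (hLeg : ∀ z ∈ U, D z * deriv A z - B z * deriv C z = 0)
    (hD0 : ∀ z ∈ U, D z ≠ 0) (hA : ∀ z ∈ U, A z = G z * C z) (hB : ∀ z ∈ U, B z = Gs z * D z) :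
    ∀ z ∈ U, deriv G z * C z + (G z - Gs z) * deriv C z = 0 := by
  intro z hz
  have hU := hUo.mem_nhds hz
  have hA' : deriv A z = deriv G z * C z + G z * deriv C z := by
    have hEq : A =ᶠ[nhds z] G * C := Filter.eventuallyEq_of_mem hU hA
    rw [hEq.deriv_eq, deriv_mul (hG.differentiableAt hU) (hC.differentiableAt hU)]
  have h := hLeg z hz
  rw [hA', hB z hz] at h
  apply mul_left_cancel₀ (hD0 z hz)
  linear_combination h

/-- A Legendrian curve with prescribed hyperbolic Gauss maps `(G, G*)` is
unique up to right multiplication by a constant diagonal matrix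
`diag(λ, λ⁻¹)`. -/
theorem stmt_13 (U : Set ℂ) (hUo : IsOpen U) (hUc : IsConnected U)
    (G Gs A B C D A₂ B₂ C₂ D₂ : ℂ → ℂ)
    (hG : DifferentiableOn ℂ G U) (hGs : DifferentiableOn ℂ Gs U)
    (hA : DifferentiableOn ℂ A U) (hB : DifferentiableOn ℂ B U)
    (hC : DifferentiableOn ℂ C U) (hD : DifferentiableOn ℂ D U)
    (hA₂ : DifferentiableOn ℂ A₂ U) (hB₂ : DifferentiableOn ℂ B₂ U)
    (hC₂ : DifferentiableOn ℂ C₂ U) (hD₂ : DifferentiableOn ℂ D₂ U)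
    (hGGs : ∀ z ∈ U, G z - Gs z ≠ 0)
    (hdet : ∀ z ∈ U, A z * D z - B z * C z = 1)
    (hLeg : ∀ z ∈ U, D z * deriv A z - B z * deriv C z = 0)
    (hdet₂ : ∀ z ∈ U, A₂ z * D₂ z - B₂ z * C₂ z = 1)
    (hLeg₂ : ∀ z ∈ U, D₂ z * deriv A₂ z - B₂ z * deriv C₂ z = 0)
    (hC0 : ∀ z ∈ U, C z ≠ 0) (hD0 : ∀ z ∈ U, D z ≠ 0)
    (hC₂0 : ∀ z ∈ U, C₂ z ≠ 0) (hD₂0 : ∀ z ∈ U, D₂ z ≠ 0)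
    (hG1 : ∀ z ∈ U, A z / C z = G z)
    (hG2 : ∀ z ∈ U, A₂ z / C₂ z = G z)
    (hGs1 : ∀ z ∈ U, B z / D z = Gs z)
    (hGs2 : ∀ z ∈ U, B₂ z / D₂ z = Gs z) :
    ∃ lam : ℂ, lam ≠ 0 ∧
      ∀ z ∈ U, A₂ z = lam * A z ∧ C₂ z = lam * C z ∧
        B₂ z = B z / lam ∧ D₂ z = D z / lam := by
  have hA1 : ∀ z ∈ U, A z = G z * C z := fun z hz => (div_eq_iff (hC0 z hz)).mp (hG1 z hz)
  have hA2 : ∀ z ∈ U, A₂ z = G z * C₂ z := fun z hz => (div_eq_iff (hC₂0 z hz)).mp (hG2 z hz)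
  have hB1 : ∀ z ∈ U, B z = Gs z * D z := fun z hz => (div_eq_iff (hD0 z hz)).mp (hGs1 z hz)
  have hB2 : ∀ z ∈ U, B₂ z = Gs z * D₂ z := fun z hz => (div_eq_iff (hD₂0 z hz)).mp (hGs2 z hz)
  have ode := legendrian_linear_ode hUo hG hC hLeg hD0 hA1 hB1
  have ode₂ := legendrian_linear_ode hUo hG hC₂ hLeg₂ hD₂0 hA2 hB2
  have hderiv : U.EqOn (deriv (C₂ / C)) 0 := by
    intro z hz
    have hU := hUo.mem_nhds hz
    rw [deriv_div (hC₂.differentiableAt hU) (hC.differentiableAt hU) (hC0 z hz)]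
    have hW : deriv C₂ z * C z - C₂ z * deriv C z = 0 := by
      apply mul_left_cancel₀ (hGGs z hz)
      linear_combination C z * ode₂ z hz - C₂ z * ode z hz
    rw [hW, zero_div, Pi.zero_apply]
  obtain ⟨lam, hlam⟩ := hUo.exists_is_const_of_deriv_eq_zero hUc.isPreconnected
    (hC₂.div hC hC0) hderiv
  have hC₂eq : ∀ z ∈ U, C₂ z = lam * C z := fun z hz => (div_eq_iff (hC0 z hz)).mp (hlam z hz)
  have hlam0 : lam ≠ 0 := by
    obtain ⟨z, hz⟩ := hUc.nonempty
    rintro rfl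
    exact hC₂0 z hz (by rw [hC₂eq z hz, zero_mul])
  refine ⟨lam, hlam0, fun z hz => ?_⟩
  have hD₂eq : D₂ z = D z / lam := by
    rw [eq_div_iff hlam0]
    have h := hdet z hz
    have h₂ := hdet₂ z hz
    rw [hA1 z hz, hB1 z hz] at h
    rw [hA2 z hz, hB2 z hz, hC₂eq z hz] at h₂
    apply mul_left_cancel₀ (mul_ne_zero (hGGs z hz) (hC0 z hz))
    linear_combination h₂ - h
  refine ⟨?_, hC₂eq z hz, ?_, hD₂eq⟩
  · rw [hA2 z hz, hA1 z hz, hC₂eq z hz]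
    ring
  · rw [hB2 z hz, hB1 z hz, hD₂eq]
    ring
end

section
/- Let U ⊆ ℂ be a nonempty open connected set, let G be holomorphic on U with G' nowhere zero, let w be a nowhere-zero holomorphic function on U, and let (A,B,C,D) and (Ã,B̃,C̃,D̃) be two quadruples of holomorphic functions on U, each satisfying A·D − B·C = 1 and D·A' − B·C' = 0, with C and C̃ nowhere zero, with the same hyperbolic Gauss map A/C = Ã/C̃ = G and the same canonical form A·C' − C·A' = Ã·C̃' − C̃·Ã' = w. Then there exists ε ∈ {1, −1} such that Ã = ε·A, B̃ = ε·B, C̃ = ε·C, D̃ = ε·D on U. That is, a Legendrian curve in PSL(2,ℂ) is uniquely determined by the pair (G, ω) of its hyperbolic Gauss map and canonical form. -/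
open Complex

/-- The canonical form of a Legendrian curve is `-C² G'`, where `G = A / C` on `U`. -/
lemma canonicalForm_eq_neg_sq_mul_deriv {U : Set ℂ} (hUo : IsOpen U) {G A C : ℂ → ℂ}
    (hA : DifferentiableOn ℂ A U) (hC : DifferentiableOn ℂ C U) (hC0 : ∀ z ∈ U, C z ≠ 0)
    (hG : ∀ z ∈ U, A z / C z = G z) {z : ℂ} (hz : z ∈ U) :
    A z * deriv C z - C z * deriv A z = -(C z ^ 2 * deriv G z) := by
  have hU := hUo.mem_nhds hz
  have hGe : G =ᶠ[nhds z] fun x => A x / C x := by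
    filter_upwards [hU] with x hx using (hG x hx).symm
  have hC0z := hC0 z hz
  rw [hGe.deriv_eq, deriv_fun_div (hA.differentiableAt hU) (hC.differentiableAt hU) hC0z]
  field_simp
  ring

/-- If `f` is a constant multiple of `g` on an open set, so is its derivative. -/
lemma deriv_eq_const_mul_of_eqOn {U : Set ℂ} (hUo : IsOpen U) {f g : ℂ → ℂ} {c : ℂ}
    (h : ∀ z ∈ U, f z = c * g z) {z : ℂ} (hz : z ∈ U) : deriv f z = c * deriv g z := by
  have he : f =ᶠ[nhds z] fun x => c * g x := by
    filter_upwards [hUo.mem_nhds hz] with x hx using h x hx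
  rw [he.deriv_eq, deriv_const_mul_field]

/-- A Legendrian curve in PSL(2,ℂ) is uniquely determined by the pair
`(G, ω)` of its hyperbolic Gauss map and canonical form: two such curves
agree up to an overall sign. -/
theorem stmt_14 (U : Set ℂ) (hUo : IsOpen U) (hUc : IsConnected U)
    (G w A B C D A₂ B₂ C₂ D₂ : ℂ → ℂ)
    (hG : DifferentiableOn ℂ G U) (hw : DifferentiableOn ℂ w U)
    (hA : DifferentiableOn ℂ A U) (hB : DifferentiableOn ℂ B U)
    (hC : DifferentiableOn ℂ C U) (hD : DifferentiableOn ℂ D U)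
    (hA₂ : DifferentiableOn ℂ A₂ U) (hB₂ : DifferentiableOn ℂ B₂ U)
    (hC₂ : DifferentiableOn ℂ C₂ U) (hD₂ : DifferentiableOn ℂ D₂ U)
    (hG' : ∀ z ∈ U, deriv G z ≠ 0)
    (hw0 : ∀ z ∈ U, w z ≠ 0)
    (hdet : ∀ z ∈ U, A z * D z - B z * C z = 1)
    (hLeg : ∀ z ∈ U, D z * deriv A z - B z * deriv C z = 0)
    (hdet₂ : ∀ z ∈ U, A₂ z * D₂ z - B₂ z * C₂ z = 1)
    (hLeg₂ : ∀ z ∈ U, D₂ z * deriv A₂ z - B₂ z * deriv C₂ z = 0)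
    (hC0 : ∀ z ∈ U, C z ≠ 0) (hC₂0 : ∀ z ∈ U, C₂ z ≠ 0)
    (hG1 : ∀ z ∈ U, A z / C z = G z)
    (hG2 : ∀ z ∈ U, A₂ z / C₂ z = G z)
    (hw1 : ∀ z ∈ U, A z * deriv C z - C z * deriv A z = w z)
    (hw2 : ∀ z ∈ U, A₂ z * deriv C₂ z - C₂ z * deriv A₂ z = w z) :
    ∃ ε : ℂ, (ε = 1 ∨ ε = -1) ∧
      ∀ z ∈ U, A₂ z = ε * A z ∧ B₂ z = ε * B z ∧
        C₂ z = ε * C z ∧ D₂ z = ε * D z := by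
  have hsq : ∀ z ∈ U, C₂ z ^ 2 = C z ^ 2 := fun z hz => by
    have h1 := canonicalForm_eq_neg_sq_mul_deriv hUo hA hC hC0 hG1 hz
    have h2 := canonicalForm_eq_neg_sq_mul_deriv hUo hA₂ hC₂ hC₂0 hG2 hz
    rw [hw1 z hz] at h1
    rw [hw2 z hz, h1] at h2
    exact mul_right_cancel₀ (hG' z hz) (neg_injective h2).symm
  obtain ⟨ε, hε, hCε⟩ : ∃ ε : ℂ, (ε = 1 ∨ ε = -1) ∧ ∀ z ∈ U, C₂ z = ε * C z := by
    rcases hUc.isPreconnected.eq_or_eq_neg_of_sq_eq hC₂.continuousOn hC.continuousOn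
      (fun z hz => by simpa using hsq z hz) (fun {z} hz => hC0 z hz) with h | h
    · exact ⟨1, Or.inl rfl, fun z hz => by simpa using h hz⟩
    · exact ⟨-1, Or.inr rfl, fun z hz => by simpa using h hz⟩
  have hAε : ∀ z ∈ U, A₂ z = ε * A z := fun z hz => by
    rw [(div_eq_iff (hC₂0 z hz)).1 (hG2 z hz), (div_eq_iff (hC0 z hz)).1 (hG1 z hz), hCε z hz]
    ring
  refine ⟨ε, hε, fun z hz => ⟨hAε z hz, ?_, hCε z hz, ?_⟩⟩
  · have hA' := deriv_eq_const_mul_of_eqOn hUo hAε hz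
    apply mul_right_cancel₀ (hw0 z hz)
    linear_combination -B₂ z * hw2 z hz + deriv A₂ z * hdet₂ z hz - A₂ z * hLeg₂ z hz
      + ε * (B z * hw1 z hz - deriv A z * hdet z hz + A z * hLeg z hz) + hA'
  · have hC' := deriv_eq_const_mul_of_eqOn hUo hCε hz
    apply mul_right_cancel₀ (hw0 z hz)
    linear_combination -D₂ z * hw2 z hz + deriv C₂ z * hdet₂ z hz - C₂ z * hLeg₂ z hz
      + ε * (D z * hw1 z hz - deriv C z * hdet z hz + C z * hLeg z hz) + hC'
end

section
/- Let U ⊆ ℂ be a nonempty open connected set, let g, h be holomorphic functions on U with g' nowhere zero on U, and define h₁ := h'/g' and h₂ := h₁'/g'. Define F¹ := g·h₁ − h + (1 − g²)·h₂/2, F² := i·(h − g·h₁ + (1 + g²)·h₂/2), F³ := g·h₂ − h₁. Then at every point of U: (F¹)' = (1 − g²)·h₂'/2, (F²)' = i·(1 + g²)·h₂'/2, (F³)' = g·h₂', and consequently ((F¹)')² + ((F²)')² + ((F³)')² = 0, i.e. F = (F¹,F²,F³) is a null curve in ℂ³ with Weierstrass data (g, h₂') given in integral-free form. -/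
open Complex

/-- The integral-free representation formula for null curves in ℂ³:
for a pair `(g, h)` of holomorphic functions, the map
`F = (g·h₁ − h + (1 − g²)·h₂/2, i(h − g·h₁ + (1 + g²)·h₂/2), g·h₂ − h₁)`
is a null curve with Weierstrass data `(g, h₂')`. -/
theorem stmt_16 (U : Set ℂ) (hUo : IsOpen U) (hUc : IsConnected U)
    (g h h₁ h₂ F₁ F₂ F₃ : ℂ → ℂ)
    (hg : DifferentiableOn ℂ g U) (hh : DifferentiableOn ℂ h U)
    (hg' : ∀ z ∈ U, deriv g z ≠ 0)
    (hh₁def : ∀ z, h₁ z = deriv h z / deriv g z)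
    (hh₂def : ∀ z, h₂ z = deriv h₁ z / deriv g z)
    (hF₁def : ∀ z, F₁ z = g z * h₁ z - h z + (1 - (g z) ^ 2) * h₂ z / 2)
    (hF₂def : ∀ z,
      F₂ z = Complex.I * (h z - g z * h₁ z + (1 + (g z) ^ 2) * h₂ z / 2))
    (hF₃def : ∀ z, F₃ z = g z * h₂ z - h₁ z) :
    ∀ z ∈ U, deriv F₁ z = (1 - (g z) ^ 2) * deriv h₂ z / 2 ∧
      deriv F₂ z = Complex.I * (1 + (g z) ^ 2) * deriv h₂ z / 2 ∧
      deriv F₃ z = g z * deriv h₂ z ∧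
      (deriv F₁ z) ^ 2 + (deriv F₂ z) ^ 2 + (deriv F₃ z) ^ 2 = 0 := by
  have dh₁ : DifferentiableOn ℂ h₁ U := by
    rw [funext hh₁def]
    exact (hh.deriv hUo).fun_div (hg.deriv hUo) hg'
  have dh₂ : DifferentiableOn ℂ h₂ U := by
    rw [funext hh₂def]
    exact (dh₁.deriv hUo).fun_div (hg.deriv hUo) hg'
  intro z hz
  have hU := hUo.mem_nhds hz
  have Dg := (hg.differentiableAt hU).hasDerivAt
  have Dh : HasDerivAt h (h₁ z * deriv g z) z := by
    rw [hh₁def, div_mul_cancel₀ _ (hg' z hz)]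
    exact (hh.differentiableAt hU).hasDerivAt
  have Dh₁ : HasDerivAt h₁ (h₂ z * deriv g z) z := by
    rw [hh₂def, div_mul_cancel₀ _ (hg' z hz)]
    exact (dh₁.differentiableAt hU).hasDerivAt
  have Dh₂ := (dh₂.differentiableAt hU).hasDerivAt
  have e₁ : deriv F₁ z = (1 - (g z) ^ 2) * deriv h₂ z / 2 := by
    rw [funext hF₁def]
    refine ((((Dg.fun_mul Dh₁).fun_sub Dh).fun_add
      ((((Dg.fun_pow 2).const_sub 1).fun_mul Dh₂).div_const 2)).congr_deriv ?_).deriv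
    push_cast
    ring
  have e₂ : deriv F₂ z = Complex.I * (1 + (g z) ^ 2) * deriv h₂ z / 2 := by
    rw [funext hF₂def]
    refine ((((Dh.fun_sub (Dg.fun_mul Dh₁)).fun_add
      ((((Dg.fun_pow 2).const_add 1).fun_mul Dh₂).div_const 2)).const_mul
        Complex.I).congr_deriv ?_).deriv
    push_cast
    ring
  have e₃ : deriv F₃ z = g z * deriv h₂ z := by
    rw [funext hF₃def]
    refine (((Dg.fun_mul Dh₂).fun_sub Dh₁).congr_deriv ?_).deriv
    ring
  refine ⟨e₁, e₂, e₃, ?_⟩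
  rw [e₁, e₂, e₃]
  linear_combination ((1 + (g z) ^ 2) * deriv h₂ z / 2) ^ 2 * Complex.I_sq
end

section
/- Let U ⊆ ℂ be a nonempty open connected set and let F¹, F², F³ be holomorphic functions on U with ((F¹)')² + ((F²)')² + ((F³)')² = 0 on U. Set h₂ := F¹ − i·F², ψ := −F¹ − i·F², ω := h₂', and assume ω is nowhere zero on U; set g := (F³)'/ω, h₁ := h₂·g − F³, and h := (ψ − h₂·g² + 2·h₁·g)/2. Then at every point of U: ψ' = g²·ω, h₁' = g'·h₂, and h' = g'·h₁. That is, h₂ = dh₁/dg and h₁ = dh/dg wherever g' ≠ 0, which yields the integral-free representation of the null curve F. -/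
open Complex

/-- Derivation of the integral-free representation of a null curve in ℂ³:
`ψ' = g²·ω`, `h₁' = g'·h₂` and `h' = g'·h₁`. -/
theorem stmt_17 (U : Set ℂ) (hUo : IsOpen U) (hUc : IsConnected U)
    (F₁ F₂ F₃ h₂ ψ w g h₁ h : ℂ → ℂ)
    (hF₁ : DifferentiableOn ℂ F₁ U) (hF₂ : DifferentiableOn ℂ F₂ U)
    (hF₃ : DifferentiableOn ℂ F₃ U)
    (hnull : ∀ z ∈ U,
      (deriv F₁ z) ^ 2 + (deriv F₂ z) ^ 2 + (deriv F₃ z) ^ 2 = 0)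
    (hh₂def : ∀ z, h₂ z = F₁ z - Complex.I * F₂ z)
    (hψdef : ∀ z, ψ z = -F₁ z - Complex.I * F₂ z)
    (hwdef : ∀ z, w z = deriv h₂ z)
    (hw0 : ∀ z ∈ U, w z ≠ 0)
    (hgdef : ∀ z, g z = deriv F₃ z / w z)
    (hh₁def : ∀ z, h₁ z = h₂ z * g z - F₃ z)
    (hhdef : ∀ z, h z = (ψ z - h₂ z * (g z) ^ 2 + 2 * h₁ z * g z) / 2) :
    ∀ z ∈ U, deriv ψ z = (g z) ^ 2 * w z ∧
      deriv h₁ z = deriv g z * h₂ z ∧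
      deriv h z = deriv g z * h₁ z := by
  intro z hz
  have hUz : U ∈ nhds z := hUo.mem_nhds hz
  have d₁ := (hF₁.differentiableAt hUz).hasDerivAt
  have d₂ := (hF₂.differentiableAt hUz).hasDerivAt
  have d₃ := (hF₃.differentiableAt hUz).hasDerivAt
  have hh₂ : DifferentiableOn ℂ h₂ U := by
    rw [funext hh₂def]
    exact hF₁.sub (hF₂.const_mul _)
  have dh₂ : HasDerivAt h₂ (w z) z := by
    rw [hwdef]
    exact (hh₂.differentiableAt hUz).hasDerivAt
  have hw : w z = deriv F₁ z - Complex.I * deriv F₂ z := by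
    have key := d₁.sub (d₂.const_mul Complex.I)
    exact dh₂.unique (key.congr_of_eventuallyEq (.of_forall hh₂def))
  have dg : HasDerivAt g (deriv g z) z := by
    have hdg : DifferentiableOn ℂ g U := by
      rw [funext hgdef, funext hwdef]
      exact (hF₃.deriv hUo).div (hh₂.deriv hUo) fun x hx => hwdef x ▸ hw0 x hx
    exact (hdg.differentiableAt hUz).hasDerivAt
  have hgw : deriv F₃ z = g z * w z := by
    rw [hgdef, div_mul_cancel₀ _ (hw0 z hz)]
  have hψ : -deriv F₁ z - Complex.I * deriv F₂ z = g z ^ 2 * w z := by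
    apply mul_right_cancel₀ (hw0 z hz)
    have hn := hnull z hz
    rw [hgw] at hn
    calc (-deriv F₁ z - Complex.I * deriv F₂ z) * w z
        = -(deriv F₁ z) ^ 2 - (deriv F₂ z) ^ 2 := by
          rw [hw]
          linear_combination (deriv F₂ z) ^ 2 * Complex.I_sq
      _ = g z ^ 2 * w z * w z := by linear_combination -hn
  have dψ : HasDerivAt ψ (g z ^ 2 * w z) z := by
    rw [← hψ]
    exact (d₁.neg.sub (d₂.const_mul Complex.I)).congr_of_eventuallyEq (.of_forall hψdef)
  have dh₁ : HasDerivAt h₁ (deriv g z * h₂ z) z := by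
    refine (((dh₂.mul dg).sub d₃).congr_of_eventuallyEq (.of_forall hh₁def)).congr_deriv ?_
    linear_combination -hgw
  have dh : HasDerivAt h (deriv g z * h₁ z) z := by
    refine ((((dψ.sub (dh₂.mul (dg.pow 2))).add ((dh₁.const_mul 2).mul dg)).div_const
      2).congr_of_eventuallyEq (.of_forall hhdef)).congr_deriv ?_
    simp only [Pi.pow_apply]
    push_cast
    ring
  exact ⟨dψ.deriv, dh₁.deriv, dh.deriv⟩
end
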